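/- Let k, d ≥ 1, let g : ℝ^k × ℝ^{k×d} → ℝ^k, let 0 < a ≤ b, v ≥ 0, ψ ≥ 0, r' > 0 be real numbers and V ∈ ℝ^{k×d}. Assume: (i) ‖g(y, z₁) − g(y, z₂)‖ ≤ v‖z₁ − z₂‖ for all y, z₁, z₂; and (ii) ‖g(y, 0) − g(0, 0)‖ ≤ ψ for all y with ‖y‖ ≤ r'. For c > 0 define h_c(y) := (c / max(ψ, c)) · (g(y, π_c(V)) − g(0, π_c(V))) + g(0, V). Then for every y ∈ ℝ^k with ‖y‖ ≤ r', ‖h_b(y) − h_a(y)‖ ≤ 2v‖V‖ · 1_{‖V‖ > a} + 2v‖V‖ · 1_{ψ > a} + ψ · 1_{ψ > a}. -/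

import Mathlib

open scoped RealInnerProductSpace

/-- Radial truncation `π_c(x) := (c / max(c, ‖x‖)) • x`. -/
noncomputable def radialTrunc {E : Type*} [NormedAddCommGroup E] [NormedSpace ℝ E]
    (c : ℝ) (x : E) : E := (c / max c ‖x‖) • x

/-- The truncated generator `h_c(y)`. -/
noncomputable def truncGen {k d : ℕ}
    (g : EuclideanSpace ℝ (Fin k) → EuclideanSpace ℝ (Fin k × Fin d) → EuclideanSpace ℝ (Fin k))
    (ψ : ℝ) (V : EuclideanSpace ℝ (Fin k × Fin d)) (c : ℝ)
    (y : EuclideanSpace ℝ (Fin k)) : EuclideanSpace ℝ (Fin k) :=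
  (c / max ψ c) • (g y (radialTrunc c V) - g 0 (radialTrunc c V)) + g 0 V

theorem aux_ratio (c m : ℝ) (hc : 0 < c) :
    0 ≤ c / max c m ∧ c / max c m ≤ 1 ∧ (m ≤ c → c / max c m = 1) := by
  have h : 0 < max c m := lt_max_of_lt_left hc
  refine ⟨by positivity, (div_le_one h).2 (le_max_left _ _), fun hm => ?_⟩
  rw [max_eq_left hm, div_self hc.ne']

theorem aux_ind (s t p m a : ℝ) (hs : 0 ≤ s ∧ s ≤ 1 ∧ (m ≤ p → s = 1))
    (ht : 0 ≤ t ∧ t ≤ 1 ∧ (m ≤ a → t = 1)) (hap : a ≤ p) :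
    |s - t| ≤ (if a < m then (1 : ℝ) else 0) := by
  split_ifs with h
  · rw [abs_le]; constructor <;> linarith [hs.1, hs.2.1, ht.1, ht.2.1]
  · rw [hs.2.2 (by linarith), ht.2.2 (by linarith)]; simp

theorem truncGen_diff_bound (k d : ℕ) (hk : 1 ≤ k) (hd : 1 ≤ d)
    (g : EuclideanSpace ℝ (Fin k) → EuclideanSpace ℝ (Fin k × Fin d) → EuclideanSpace ℝ (Fin k))
    (a b v ψ r' : ℝ) (ha : 0 < a) (hab : a ≤ b) (hv : 0 ≤ v) (hψ : 0 ≤ ψ) (hr' : 0 < r')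
    (V : EuclideanSpace ℝ (Fin k × Fin d))
    (hlip : ∀ (y : EuclideanSpace ℝ (Fin k)) (z₁ z₂ : EuclideanSpace ℝ (Fin k × Fin d)),
      ‖g y z₁ - g y z₂‖ ≤ v * ‖z₁ - z₂‖)
    (hgrow : ∀ y : EuclideanSpace ℝ (Fin k), ‖y‖ ≤ r' → ‖g y 0 - g 0 0‖ ≤ ψ)
    (y : EuclideanSpace ℝ (Fin k)) (hy : ‖y‖ ≤ r') :
    ‖truncGen g ψ V b y - truncGen g ψ V a y‖ ≤
      2 * v * ‖V‖ * (if a < ‖V‖ then (1 : ℝ) else 0)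
        + 2 * v * ‖V‖ * (if a < ψ then (1 : ℝ) else 0)
        + ψ * (if a < ψ then (1 : ℝ) else 0) := by
  have hb : 0 < b := ha.trans_le hab
  have hS := aux_ind _ _ b ψ a (aux_ratio b ψ hb) (aux_ratio a ψ ha) hab
  have hT := aux_ind _ _ b ‖V‖ a (aux_ratio b ‖V‖ hb) (aux_ratio a ‖V‖ ha) hab
  have hsb := aux_ratio b ψ hb
  have hta := aux_ratio a ‖V‖ ha
  unfold truncGen radialTrunc
  rw [max_comm ψ b, max_comm ψ a]
  generalize b / max b ψ = sb at *
  generalize a / max a ψ = sa at *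
  generalize b / max b ‖V‖ = tb at *
  generalize a / max a ‖V‖ = ta at *
  generalize (if a < ‖V‖ then (1 : ℝ) else 0) = I at *
  generalize (if a < ψ then (1 : ℝ) else 0) = J at *
  have hD : ∀ x, ‖g x (tb • V) - g x (ta • V)‖ ≤ v * (I * ‖V‖) := fun x => by
    refine (hlip x _ _).trans ?_
    rw [← sub_smul, norm_smul, Real.norm_eq_abs]
    gcongr
  have hA : ∀ x, ‖g x (ta • V) - g x 0‖ ≤ v * ‖V‖ := fun x => by
    refine (hlip x _ _).trans ?_
    rw [sub_zero, norm_smul, Real.norm_eq_abs, abs_of_nonneg hta.1]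
    have := mul_le_mul_of_nonneg_right hta.2.1 (norm_nonneg V)
    rw [one_mul] at this
    gcongr
  have h1 : ‖(g y (tb • V) - g y (ta • V)) - (g 0 (tb • V) - g 0 (ta • V))‖
      ≤ 2 * v * ‖V‖ * I := by
    refine (norm_sub_le _ _).trans ?_
    linarith [hD y, hD 0]
  have h2 : ‖g y (ta • V) - g 0 (ta • V)‖ ≤ 2 * v * ‖V‖ + ψ := by
    have e : g y (ta • V) - g 0 (ta • V)
      = (g y (ta • V) - g y 0) - (g 0 (ta • V) - g 0 0) + (g y 0 - g 0 0) := by abel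
    rw [e]
    refine (norm_add_le _ _).trans ?_
    linarith [norm_sub_le (g y (ta • V) - g y 0) (g 0 (ta • V) - g 0 0), hA y, hA 0, hgrow y hy]
  have e : sb • (g y (tb • V) - g 0 (tb • V)) + g 0 V
      - (sa • (g y (ta • V) - g 0 (ta • V)) + g 0 V)
      = sb • ((g y (tb • V) - g y (ta • V)) - (g 0 (tb • V) - g 0 (ta • V)))
        + (sb - sa) • (g y (ta • V) - g 0 (ta • V)) := by module
  rw [e]
  refine (norm_add_le _ _).trans ?_
  rw [norm_smul, norm_smul, Real.norm_eq_abs, Real.norm_eq_abs, abs_of_nonneg hsb.1]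
  have h3 := mul_le_mul hsb.2.1 h1 (norm_nonneg _) zero_le_one
  have h4 := mul_le_mul hS h2 (norm_nonneg _) ((abs_nonneg _).trans hS)
  linarith
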